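/- With the CGMY data below, lim_{t→0⁺} (L(t) - d₁)/t^{1-1/Y} = d₂, where d₂ := (1/π)·∫₀^∞ ((w² + 1/4)·θ₀(w) - w²·Re ψ₀(w)) / (w²·(w² + 1/4)) dw. (This is the second-order at-the-money expansion c(t,0) = d₁·t^{1/Y} + d₂·t + o(t) expressed through the Lipton–Lewis representation c(t,0) = t^{1/Y}·L(t).) -/

import Mathlib

open MeasureTheory Filter Topology Complex

/-- The stable scale coefficient `σ_Y = 2·C·Γ(-Y)·|cos(πY/2)|`. -/
noncomputable def sigmaY (C Y : ℝ) : ℝ :=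
  2 * C * Real.Gamma (-Y) * |Real.cos (Real.pi * Y / 2)|

/-- The martingale drift `b̃`. -/
noncomputable def btilde (C G M Y : ℝ) : ℝ :=
  -(C * Real.Gamma (-Y) * ((M - 1) ^ Y + (G + 1) ^ Y - M ^ Y - G ^ Y))

/-- The constant `κ = b̃/2 - C·Γ(-Y)·(M^Y + G^Y)`. -/
noncomputable def kappaC (C G M Y : ℝ) : ℝ :=
  btilde C G M Y / 2 - C * Real.Gamma (-Y) * (M ^ Y + G ^ Y)

/-- The limiting stable exponent `θ₀(u) = -σ_Y·|u|^Y`. -/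
noncomputable def theta0 (C Y : ℝ) (u : ℝ) : ℝ :=
  -(sigmaY C Y) * |u| ^ Y

/-- The contour-shifted characteristic exponent `ψ₀`. -/
noncomputable def psi0 (C G M Y : ℝ) (v : ℝ) : ℂ :=
  Complex.I * (v : ℂ) * ((btilde C G M Y : ℝ) : ℂ) + ((kappaC C G M Y : ℝ) : ℂ)
    + ((C * Real.Gamma (-Y) : ℝ) : ℂ) *
      ((((M - 1/2 : ℝ) : ℂ) - Complex.I * (v : ℂ)) ^ (Y : ℂ)
        + (((G + 1/2 : ℝ) : ℂ) + Complex.I * (v : ℂ)) ^ (Y : ℂ))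

/-- The rescaled exponent `θ(t,v)` in the Lipton–Lewis representation. -/
noncomputable def thetaT (C G M Y : ℝ) (t v : ℝ) : ℂ :=
  Complex.I * (v : ℂ) * ((btilde C G M Y : ℝ) : ℂ) * ((t ^ (1 - 1/Y) : ℝ) : ℂ)
    + ((kappaC C G M Y : ℝ) : ℂ) * (t : ℂ)
    + ((C * Real.Gamma (-Y) : ℝ) : ℂ) *
      (((((M - 1/2) * t ^ (1/Y) : ℝ) : ℂ) - Complex.I * (v : ℂ)) ^ (Y : ℂ)
        + ((((G + 1/2) * t ^ (1/Y) : ℝ) : ℂ) + Complex.I * (v : ℂ)) ^ (Y : ℂ))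

/-- The normalized Lipton–Lewis ATM factor `L(t)`. -/
noncomputable def LLfn (C G M Y : ℝ) (t : ℝ) : ℝ :=
  (1 / Real.pi) *
    (∫ v in Set.Ioi (0 : ℝ),
      (1 - Complex.exp (thetaT C G M Y t v)) / (((v ^ 2 + t ^ (2/Y) / 4 : ℝ)) : ℂ)).re

/-- The first-order coefficient `d₁`. -/
noncomputable def dOne (C Y : ℝ) : ℝ :=
  (1 / Real.pi) * Real.Gamma (1 - 1/Y) * (sigmaY C Y) ^ (1/Y)

/-- The second-order coefficient `d₂`. -/
noncomputable def dTwo (C G M Y : ℝ) : ℝ :=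
  (1 / Real.pi) * ∫ w in Set.Ioi (0 : ℝ),
    ((w ^ 2 + 1/4) * theta0 C Y w - w ^ 2 * (psi0 C G M Y w).re) / (w ^ 2 * (w ^ 2 + 1/4))

/-- The complex exponential is `e^K`-Lipschitz on the half plane `re z ≤ K`. -/
lemma norm_cexp_sub_cexp_le {K : ℝ} {a b : ℂ} (ha : a.re ≤ K) (hb : b.re ≤ K) :
    ‖Complex.exp a - Complex.exp b‖ ≤ Real.exp K * ‖a - b‖ := by
  refine (convex_halfSpace_re_le K).norm_image_sub_le_of_norm_hasDerivWithin_le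
    (f := Complex.exp) (f' := Complex.exp)
    (fun z _ => (Complex.hasDerivAt_exp z).hasDerivWithinAt) (fun z hz => ?_) hb ha
  rw [Complex.norm_exp]
  exact Real.exp_le_exp.mpr hz

lemma norm_one_sub_cexp_le {K : ℝ} (hK : 0 ≤ K) {z : ℂ} (hz : z.re ≤ K) :
    ‖1 - Complex.exp z‖ ≤ Real.exp K * ‖z‖ := by
  simpa using norm_cexp_sub_cexp_le (a := 0) (by simpa using hK) hz

lemma one_sub_exp_neg_le (x : ℝ) : 1 - Real.exp (-x) ≤ x := by
  linarith [Real.add_one_le_exp (-x)]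

lemma mul_exp_neg_le_one (x : ℝ) : x * Real.exp (-x) ≤ 1 := by
  have h := Real.add_one_le_exp x
  rw [Real.exp_neg, ← div_eq_mul_inv, div_le_one (Real.exp_pos x)]
  linarith

/-- Shifting a point of the imaginary axis by `a` changes its `Y`-th power by at most the order
of the `(Y - 1)`-st power. -/
lemma norm_add_I_mul_cpow_sub_le {a w Y : ℝ} (ha : 0 ≤ a) (hw : w ≠ 0) (hY1 : 1 ≤ Y)
    (hY2 : Y ≤ 2) :
    ‖((a : ℂ) + Complex.I * w) ^ (Y : ℂ) - (Complex.I * w) ^ (Y : ℂ)‖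
      ≤ Y * (a ^ (Y - 1) + |w| ^ (Y - 1)) * a := by
  have key := (convex_Icc (0 : ℝ) a).norm_image_sub_le_of_norm_hasDerivWithin_le
    (f := fun x : ℝ => ((x : ℂ) + Complex.I * w) ^ (Y : ℂ))
    (f' := fun x : ℝ => (Y : ℂ) * ((x : ℂ) + Complex.I * w) ^ ((Y : ℂ) - 1) * 1)
    (C := Y * (a ^ (Y - 1) + |w| ^ (Y - 1))) (x := 0) (y := a)
    (fun x _ => ?_) (fun x hx => ?_) ⟨le_rfl, ha⟩ ⟨ha, le_rfl⟩
  · simpa [abs_of_nonneg ha] using key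
  · refine (HasDerivAt.comp_ofReal (e := fun z : ℂ => (z + Complex.I * w) ^ (Y : ℂ))
      (HasDerivAt.cpow_const ((hasDerivAt_id _).add_const _) ?_)).hasDerivWithinAt
    rw [Complex.mem_slitPlane_iff]
    right
    simpa using hw
  · rw [mul_one, norm_mul, Complex.norm_real, Real.norm_of_nonneg (by linarith),
      show (Y : ℂ) - 1 = ((Y - 1 : ℝ) : ℂ) by push_cast; ring, Complex.norm_cpow_real]
    refine mul_le_mul_of_nonneg_left ?_ (by linarith)
    refine le_trans ?_ (Real.rpow_add_le_add_rpow ha (abs_nonneg w) (by linarith) (by linarith))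
    refine Real.rpow_le_rpow (norm_nonneg _) ?_ (by linarith)
    refine (norm_add_le _ _).trans ?_
    simp only [norm_mul, Complex.norm_I, Complex.norm_real, one_mul, Real.norm_eq_abs]
    rw [abs_of_nonneg hx.1]
    linarith [hx.2]

lemma ofReal_mul_cpow_of_pos {r : ℝ} (hr : 0 < r) {x : ℂ} (hx : x ≠ 0) (Y : ℝ) :
    ((r : ℂ) * x) ^ (Y : ℂ) = ((r ^ Y : ℝ) : ℂ) * x ^ (Y : ℂ) := by
  have hr' : (r : ℂ) ≠ 0 := Complex.ofReal_ne_zero.mpr hr.ne'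
  rw [Complex.cpow_def_of_ne_zero (mul_ne_zero hr' hx), Complex.cpow_def_of_ne_zero hx,
    Complex.log_ofReal_mul hr hx, Real.rpow_def_of_pos hr, add_mul, Complex.exp_add]
  push_cast
  rfl

lemma I_mul_cpow_add_I_mul_neg_cpow {w : ℝ} (hw : 0 < w) (Y : ℝ) :
    (Complex.I * (w : ℂ)) ^ (Y : ℂ) + (Complex.I * ((-w : ℝ) : ℂ)) ^ (Y : ℂ)
      = ((2 * Real.cos (Real.pi * Y / 2) * w ^ Y : ℝ) : ℂ) := by
  rw [show Complex.I * ((-w : ℝ) : ℂ) = (w : ℂ) * -Complex.I by push_cast; ring,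
    mul_comm Complex.I, ofReal_mul_cpow_of_pos hw Complex.I_ne_zero,
    ofReal_mul_cpow_of_pos hw (neg_ne_zero.mpr Complex.I_ne_zero),
    Complex.cpow_def_of_ne_zero Complex.I_ne_zero,
    Complex.cpow_def_of_ne_zero (neg_ne_zero.mpr Complex.I_ne_zero), Complex.log_I,
    Complex.log_neg_I]
  push_cast
  rw [Complex.two_cos, show (Real.pi : ℂ) * Y / 2 * Complex.I = Real.pi / 2 * Complex.I * Y by ring,
    show -((Real.pi : ℂ) * Y / 2) * Complex.I = -(Real.pi / 2) * Complex.I * Y by ring]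
  ring

lemma Gamma_neg_pos {Y : ℝ} (hY1 : 1 < Y) (hY2 : Y < 2) : 0 < Real.Gamma (-Y) := by
  have h1 := Real.Gamma_add_one (s := -Y) (by linarith)
  have h2 := Real.Gamma_add_one (s := -Y + 1) (by linarith)
  have h3 : 0 < Real.Gamma (-Y + 1 + 1) := Real.Gamma_pos_of_pos (by linarith)
  rw [h2, h1, ← mul_assoc] at h3
  exact pos_of_mul_pos_right h3 (by nlinarith)

lemma cos_pi_mul_div_two_neg {Y : ℝ} (hY1 : 1 < Y) (hY2 : Y < 2) :
    Real.cos (Real.pi * Y / 2) < 0 := by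
  have := Real.pi_pos
  exact Real.cos_neg_of_pi_div_two_lt_of_lt (by nlinarith) (by nlinarith)

lemma integrableOn_one_sub_exp_div_sq {b Y : ℝ} (hb : 0 < b) (hY1 : 1 < Y) :
    IntegrableOn (fun w : ℝ => (1 - Real.exp (-b * w ^ Y)) / w ^ 2) (Set.Ioi 0) := by
  have hmeas : Measurable (fun w : ℝ => (1 - Real.exp (-b * w ^ Y)) / w ^ 2) := by fun_prop
  rw [← Set.Ioc_union_Ioi_eq_Ioi zero_le_one]
  refine IntegrableOn.union ?_ ?_
  · have hint : IntegrableOn (fun w : ℝ => b * w ^ (Y - 2)) (Set.Ioc 0 1) :=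
      ((intervalIntegrable_iff_integrableOn_Ioc_of_le zero_le_one).mp
        (intervalIntegral.intervalIntegrable_rpow' (by linarith))).const_mul b
    refine hint.mono' hmeas.aestronglyMeasurable ?_
    filter_upwards [ae_restrict_mem measurableSet_Ioc] with w hw
    have hw0 : 0 < w := hw.1
    have hpos : 0 ≤ b * w ^ Y := by positivity
    have h1 := one_sub_exp_neg_le (b * w ^ Y)
    have h2 : Real.exp (-(b * w ^ Y)) ≤ 1 := Real.exp_le_one_iff.mpr (by linarith)
    rw [neg_mul, Real.norm_of_nonneg (div_nonneg (by linarith) (by positivity)),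
      Real.rpow_sub hw0, Real.rpow_two, ← mul_div_assoc]
    gcongr
  · have hint : IntegrableOn (fun w : ℝ => w ^ (-2 : ℝ)) (Set.Ioi 1) :=
      integrableOn_Ioi_rpow_of_lt (by norm_num) one_pos
    refine hint.mono' hmeas.aestronglyMeasurable ?_
    filter_upwards [ae_restrict_mem measurableSet_Ioi] with w hw
    have hw0 : 0 < w := lt_trans one_pos hw
    have hpos : 0 ≤ b * w ^ Y := by positivity
    have h2 : Real.exp (-(b * w ^ Y)) ≤ 1 := Real.exp_le_one_iff.mpr (by linarith)
    rw [neg_mul, Real.norm_of_nonneg (div_nonneg (by linarith) (by positivity)),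
      Real.rpow_neg hw0.le, Real.rpow_two, ← one_div]
    gcongr
    linarith [Real.exp_pos (-(b * w ^ Y))]

lemma integral_one_sub_exp_div_sq {b Y : ℝ} (hb : 0 < b) (hY1 : 1 < Y) :
    ∫ w in Set.Ioi (0 : ℝ), (1 - Real.exp (-b * w ^ Y)) / w ^ 2
      = b ^ (1 / Y) * Real.Gamma (1 - 1 / Y) := by
  have hint := integrableOn_one_sub_exp_div_sq hb hY1
  have hint2 : IntegrableOn (fun w : ℝ => b * Y * (w ^ (Y - 2) * Real.exp (-b * w ^ Y)))
      (Set.Ioi 0) :=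
    (integrableOn_rpow_mul_exp_neg_mul_rpow (by linarith) (by linarith) hb).const_mul _
  have hzero := integral_Ioi_of_hasDerivAt_of_tendsto
    (f := fun w : ℝ => -((1 - Real.exp (-b * w ^ Y)) / w))
    (f' := fun w : ℝ => (1 - Real.exp (-b * w ^ Y)) / w ^ 2
      - b * Y * (w ^ (Y - 2) * Real.exp (-b * w ^ Y))) (a := 0) (m := 0) ?_ ?_
    (hint.sub hint2) ?_
  · rw [integral_sub hint hint2, integral_const_mul,
      _root_.integral_rpow_mul_exp_neg_mul_rpow (by linarith) (by linarith) hb] at hzero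
    have hY : Y ≠ 0 := by linarith
    have e1 : (Y - 2 + 1) / Y = 1 - 1 / Y := by field_simp; ring
    have e2 : b ^ (1 / Y) = b * b ^ (-(Y - 2 + 1) / Y) := by
      nth_rewrite 2 [← Real.rpow_one b]
      rw [← Real.rpow_add hb]
      congr 1
      field_simp
      ring
    rw [e1] at hzero
    rw [e2]
    simp only [div_zero, neg_zero, sub_zero] at hzero
    rw [sub_eq_zero.mp hzero]
    field_simp
  · rw [ContinuousWithinAt]
    simp only [div_zero, neg_zero]
    have hlim : Tendsto (fun w : ℝ => b * w ^ (Y - 1)) (𝓝[Set.Ici 0] 0) (𝓝 0) := by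
      have : ContinuousAt (fun w : ℝ => b * w ^ (Y - 1)) 0 :=
        (Real.continuousAt_rpow_const _ _ (Or.inr (by linarith))).const_mul b
      have h := this.tendsto
      simp only [Real.zero_rpow (show Y - 1 ≠ 0 by linarith), mul_zero] at h
      exact h.mono_left nhdsWithin_le_nhds
    refine squeeze_zero_norm' ?_ hlim
    filter_upwards [self_mem_nhdsWithin] with w hw
    rcases (show (0 : ℝ) ≤ w from hw).eq_or_lt with rfl | hw0
    · simp [Real.zero_rpow (show Y - 1 ≠ 0 by linarith)]
    have hpos : 0 ≤ b * w ^ Y := by positivity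
    have h1 := one_sub_exp_neg_le (b * w ^ Y)
    have h2 : Real.exp (-(b * w ^ Y)) ≤ 1 := Real.exp_le_one_iff.mpr (by linarith)
    rw [norm_neg, neg_mul, Real.norm_of_nonneg (div_nonneg (by linarith) (by positivity)),
      Real.rpow_sub hw0, Real.rpow_one, ← mul_div_assoc]
    gcongr
  · intro w hw
    have hw0 : (0 : ℝ) < w := hw
    have h1 := ((((Real.hasDerivAt_rpow_const (p := Y) (Or.inl hw0.ne')).const_mul
      (-b)).exp.const_sub 1).div (hasDerivAt_id w) hw0.ne').neg
    refine h1.congr_deriv ?_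
    rw [Real.rpow_sub hw0, Real.rpow_sub hw0, Real.rpow_one, Real.rpow_two]
    simp only [id]
    field_simp
    ring
  · refine squeeze_zero_norm' ?_ tendsto_inv_atTop_zero
    filter_upwards [eventually_gt_atTop 0] with w hw0
    have hpos : 0 ≤ b * w ^ Y := by positivity
    have h2 : Real.exp (-(b * w ^ Y)) ≤ 1 := Real.exp_le_one_iff.mpr (by linarith)
    rw [norm_neg, neg_mul, Real.norm_of_nonneg (div_nonneg (by linarith) (by positivity)),
      ← one_div]
    gcongr
    linarith [Real.exp_pos (-(b * w ^ Y))]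

/-- The difference quotient, in rescaled variables, whose integral is `π (L(t) - d₁) / t^(1-1/Y)`:
`z` is the value at `w` of the full exponent and `-σ w ^ Y` that of the stable one. -/
noncomputable def expansionIntegrand (σ Y t w : ℝ) (z : ℂ) : ℝ :=
  ((1 - Complex.exp (t * z)).re / (w ^ 2 + 1 / 4)
    - (1 - Real.exp (-(t * σ) * w ^ Y)) / w ^ 2) / t

lemma norm_one_sub_cexp_mul_le {K t : ℝ} {z : ℂ} (hK : 0 ≤ K) (ht0 : 0 < t) (ht1 : t ≤ 1)
    (hz : z.re ≤ K) : ‖1 - Complex.exp (t * z)‖ ≤ t * (Real.exp K * ‖z‖) := by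
  refine (norm_one_sub_cexp_le hK (z := t * z) ?_).trans ?_
  · rw [Complex.re_ofReal_mul]
    nlinarith
  · rw [norm_mul, Complex.norm_real, Real.norm_of_nonneg ht0.le]
    exact le_of_eq (by ring)

lemma abs_expansionIntegrand_le_of_le_one {σ Y K B t w : ℝ} {z : ℂ} (hσ : 0 < σ)
    (hY2 : Y < 2) (hK : 0 ≤ K) (ht0 : 0 < t) (ht1 : t ≤ 1) (hw0 : 0 < w) (hw1 : w ≤ 1)
    (hz : z.re ≤ K) (hzB : ‖z‖ ≤ B) :
    |expansionIntegrand σ Y t w z| ≤ (4 * (Real.exp K * B) + σ) * w ^ (Y - 2) := by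
  have hB : 0 ≤ B := (norm_nonneg z).trans hzB
  have h1 : |(1 - Complex.exp (t * z)).re / (w ^ 2 + 1 / 4)| ≤ t * (4 * (Real.exp K * B)) := by
    rw [abs_div, abs_of_pos (show 0 < w ^ 2 + 1 / 4 by positivity), div_le_iff₀ (by positivity)]
    calc |(1 - Complex.exp (t * z)).re| ≤ ‖1 - Complex.exp (t * z)‖ := Complex.abs_re_le_norm _
      _ ≤ t * (Real.exp K * ‖z‖) := norm_one_sub_cexp_mul_le hK ht0 ht1 hz
      _ ≤ t * (Real.exp K * B) := by gcongr
      _ = t * (4 * (Real.exp K * B)) * (0 + 1 / 4) := by ring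
      _ ≤ t * (4 * (Real.exp K * B)) * (w ^ 2 + 1 / 4) := by gcongr; positivity
  have h2 : |(1 - Real.exp (-(t * σ) * w ^ Y)) / w ^ 2| ≤ t * (σ * w ^ (Y - 2)) := by
    have hpos : 0 ≤ t * σ * w ^ Y := by positivity
    have h1 := one_sub_exp_neg_le (t * σ * w ^ Y)
    have h2 : Real.exp (-(t * σ * w ^ Y)) ≤ 1 := Real.exp_le_one_iff.mpr (by linarith)
    rw [neg_mul, abs_of_nonneg (div_nonneg (by linarith) (by positivity)),
      Real.rpow_sub hw0, Real.rpow_two, ← mul_div_assoc, ← mul_div_assoc, ← mul_assoc]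
    gcongr
  have h3 : 1 ≤ w ^ (Y - 2) := Real.one_le_rpow_of_pos_of_le_one_of_nonpos hw0 hw1 (by linarith)
  rw [expansionIntegrand, abs_div, abs_of_pos ht0, div_le_iff₀ ht0]
  refine (abs_sub _ _).trans ((add_le_add h1 h2).trans ?_)
  have h4 : 0 ≤ t * (4 * (Real.exp K * B)) := by positivity
  nlinarith

lemma abs_exp_sub_re_cexp_le {σ Y K B t w : ℝ} {z : ℂ} (hσ : 0 < σ) (hK : 0 ≤ K) (ht0 : 0 < t)
    (ht1 : t ≤ 1) (hw0 : 0 < w) (hz : z.re ≤ K)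
    (hre : |z.re + σ * w ^ Y| ≤ B * w ^ (Y - 1)) (him : |z.im| ≤ B * w) :
    |Real.exp (-(t * σ) * w ^ Y) - (Complex.exp (t * z)).re|
      ≤ t * (Real.exp K * (B * w ^ (Y - 1)) + B ^ 2 / (2 * σ) * w ^ (2 - Y)) := by
  have hpos : 0 < w ^ Y := by positivity
  have hre_exp : (Complex.exp (t * z)).re = Real.exp (t * z.re) * Real.cos (t * z.im) := by
    rw [Complex.exp_re, Complex.re_ofReal_mul, Complex.im_ofReal_mul]
  have h1 : |Real.exp (-(t * σ) * w ^ Y) - Real.exp (t * z.re)|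
      ≤ t * (Real.exp K * (B * w ^ (Y - 1))) := by
    have h := norm_cexp_sub_cexp_le (K := K) (a := ((-(t * σ) * w ^ Y : ℝ) : ℂ))
      (b := ((t * z.re : ℝ) : ℂ)) (by rw [Complex.ofReal_re]; nlinarith [mul_pos ht0 hσ])
      (by rw [Complex.ofReal_re]; nlinarith)
    rw [← Complex.ofReal_exp, ← Complex.ofReal_exp, ← Complex.ofReal_sub, ← Complex.ofReal_sub,
      Complex.norm_real, Complex.norm_real, Real.norm_eq_abs, Real.norm_eq_abs,
      show -(t * σ) * w ^ Y - t * z.re = -(t * (z.re + σ * w ^ Y)) by ring, abs_neg, abs_mul,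
      abs_of_pos ht0] at h
    calc _ ≤ _ := h
      _ ≤ Real.exp K * (t * (B * w ^ (Y - 1))) := by gcongr
      _ = _ := by ring
  have h2 : Real.exp (-(t * σ) * w ^ Y) * (1 - Real.cos (t * z.im))
      ≤ t * (B ^ 2 / (2 * σ) * w ^ (2 - Y)) := by
    have hcos := Real.one_sub_sq_div_two_le_cos (x := t * z.im)
    have hsq : z.im ^ 2 ≤ (B * w) ^ 2 := sq_le_sq' (by linarith [neg_abs_le z.im])
      (by linarith [le_abs_self z.im])
    have hexp := mul_exp_neg_le_one (t * σ * w ^ Y)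
    rw [← neg_mul] at hexp
    calc Real.exp (-(t * σ) * w ^ Y) * (1 - Real.cos (t * z.im))
        ≤ Real.exp (-(t * σ) * w ^ Y) * (t ^ 2 * (B * w) ^ 2 / 2) := by
          gcongr
          nlinarith [mul_le_mul_of_nonneg_left hsq (sq_nonneg t)]
      _ = t * (B ^ 2 / (2 * σ) * (w ^ 2 / w ^ Y))
            * (t * σ * w ^ Y * Real.exp (-(t * σ) * w ^ Y)) := by
          field_simp
      _ ≤ t * (B ^ 2 / (2 * σ) * (w ^ 2 / w ^ Y)) * 1 := by gcongr
      _ = _ := by rw [Real.rpow_sub hw0, Real.rpow_two, mul_one]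
  have h3 : 0 ≤ Real.exp (-(t * σ) * w ^ Y) * (1 - Real.cos (t * z.im)) :=
    mul_nonneg (Real.exp_pos _).le (by linarith [Real.cos_le_one (t * z.im)])
  rw [hre_exp, show Real.exp (-(t * σ) * w ^ Y) - Real.exp (t * z.re) * Real.cos (t * z.im)
    = (Real.exp (-(t * σ) * w ^ Y) - Real.exp (t * z.re)) * Real.cos (t * z.im)
      + Real.exp (-(t * σ) * w ^ Y) * (1 - Real.cos (t * z.im)) by ring]
  refine (abs_add_le _ _).trans ?_
  rw [abs_mul, abs_of_nonneg h3, mul_add]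
  refine add_le_add (le_trans ?_ h1) h2
  exact mul_le_of_le_one_right (abs_nonneg _) (Real.abs_cos_le_one _)

lemma abs_expansionIntegrand_le_of_one_le {σ Y K B t w : ℝ} {z : ℂ} (hσ : 0 < σ) (hK : 0 ≤ K)
    (ht0 : 0 < t) (ht1 : t ≤ 1) (hw1 : 1 ≤ w) (hz : z.re ≤ K) (hB : 0 ≤ B)
    (hzB : ‖z‖ ≤ B * w ^ Y)
    (hre : |z.re + σ * w ^ Y| ≤ B * w ^ (Y - 1)) (him : |z.im| ≤ B * w) :
    |expansionIntegrand σ Y t w z|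
      ≤ 2 * (Real.exp K * B) * w ^ (Y - 3) + B ^ 2 / (2 * σ) * w ^ (-Y) := by
  have hw0 : 0 < w := by linarith
  have h1 : |(1 - Complex.exp (t * z)).re * (1 / (w ^ 2 + 1 / 4) - 1 / w ^ 2)|
      ≤ t * (Real.exp K * B * w ^ (Y - 3)) := by
    have ha : |(1 - Complex.exp (t * z)).re| ≤ t * (Real.exp K * (B * w ^ Y)) :=
      calc _ ≤ ‖1 - Complex.exp (t * z)‖ := Complex.abs_re_le_norm _
        _ ≤ t * (Real.exp K * ‖z‖) := norm_one_sub_cexp_mul_le hK ht0 ht1 hz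
        _ ≤ _ := by gcongr
    have hb : |1 / (w ^ 2 + 1 / 4) - 1 / w ^ 2| ≤ 1 / w ^ 3 := by
      rw [show 1 / (w ^ 2 + 1 / 4) - 1 / w ^ 2 = -(1 / (4 * (w ^ 2 + 1 / 4) * w ^ 2)) by
        field_simp; ring, abs_neg, abs_of_pos (by positivity)]
      apply one_div_le_one_div_of_le (by positivity)
      nlinarith [mul_nonneg (pow_pos hw0 3).le (sub_nonneg.mpr hw1), sq_nonneg w,
        pow_pos hw0 3]
    rw [abs_mul]
    calc _ ≤ t * (Real.exp K * (B * w ^ Y)) * (1 / w ^ 3) := by gcongr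
      _ = _ := by
        rw [Real.rpow_sub hw0, show (3 : ℝ) = ((3 : ℕ) : ℝ) by norm_num, Real.rpow_natCast]
        ring
  have h2 := abs_exp_sub_re_cexp_le hσ hK ht0 ht1 hw0 hz hre him
  have h3 : |(Real.exp (-(t * σ) * w ^ Y) - (Complex.exp (t * z)).re) / w ^ 2|
      ≤ t * (Real.exp K * B * w ^ (Y - 3) + B ^ 2 / (2 * σ) * w ^ (-Y)) := by
    rw [abs_div, abs_of_pos (pow_pos hw0 2), div_le_iff₀ (pow_pos hw0 2)]
    refine h2.trans (le_of_eq ?_)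
    have e1 : w ^ (Y - 1) = w ^ (Y - 3) * w ^ 2 := by
      rw [← Real.rpow_two, ← Real.rpow_add hw0]; congr 1; ring
    have e2 : w ^ (2 - Y) = w ^ (-Y) * w ^ 2 := by
      rw [← Real.rpow_two, ← Real.rpow_add hw0]; congr 1; ring
    rw [e1, e2]
    ring
  rw [expansionIntegrand, abs_div, abs_of_pos ht0, div_le_iff₀ ht0,
    show (1 - Complex.exp (t * z)).re / (w ^ 2 + 1 / 4)
        - (1 - Real.exp (-(t * σ) * w ^ Y)) / w ^ 2
      = (1 - Complex.exp (t * z)).re * (1 / (w ^ 2 + 1 / 4) - 1 / w ^ 2)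
        + (Real.exp (-(t * σ) * w ^ Y) - (Complex.exp (t * z)).re) / w ^ 2 by
      rw [Complex.sub_re, Complex.one_re]; ring]
  refine (abs_add_le _ _).trans ((add_le_add h1 h3).trans (le_of_eq ?_))
  ring

lemma tendsto_expansionIntegrand (σ Y w : ℝ) (z : ℂ) :
    Tendsto (fun t => expansionIntegrand σ Y t w z) (𝓝[>] 0)
      (𝓝 (-(σ * w ^ Y) / w ^ 2 - z.re / (w ^ 2 + 1 / 4))) := by
  have h1 : HasDerivAt (fun t : ℝ => (1 - Complex.exp (t * z)).re) (-z.re) 0 := by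
    have h : HasDerivAt (fun s : ℂ => 1 - Complex.exp (s * z)) (-z) ((0 : ℝ) : ℂ) := by
      have := (((hasDerivAt_id ((0 : ℝ) : ℂ)).mul_const z).cexp).const_sub 1
      simpa using this
    simpa using h.real_of_complex
  have h2 : HasDerivAt (fun t : ℝ => 1 - Real.exp (-(t * σ) * w ^ Y)) (σ * w ^ Y) 0 := by
    have := (((((hasDerivAt_id (0 : ℝ)).mul_const σ).neg).mul_const (w ^ Y)).exp).const_sub 1
    simpa using this
  have h3 := (hasDerivAt_iff_tendsto_slope_zero.mp
    ((h1.div_const (w ^ 2 + 1 / 4)).sub (h2.div_const (w ^ 2)))).mono_left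
      (nhdsWithin_mono 0 fun t (ht : 0 < t) => ht.ne')
  have hlim : -(σ * w ^ Y) / w ^ 2 - z.re / (w ^ 2 + 1 / 4)
      = -z.re / (w ^ 2 + 1 / 4) - σ * w ^ Y / w ^ 2 := by ring
  rw [hlim]
  refine h3.congr fun t => ?_
  simp [expansionIntegrand, div_eq_inv_mul]

section Exponent

variable {σ Y A b : ℝ} {ψ : ℝ → ℂ}

lemma exists_forall_re_le (hσ : 0 < σ) (hY1 : 1 < Y) (hA : 0 ≤ A)
    (hψ : ∀ w : ℝ, 0 < w → ‖ψ w + ((σ * w ^ Y : ℝ) : ℂ) - Complex.I * w * b‖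
      ≤ A * (1 + w ^ (Y - 1))) :
    ∃ K : ℝ, 0 ≤ K ∧ ∀ w : ℝ, 0 < w → (ψ w).re ≤ K := by
  refine ⟨A + A * (A / σ) ^ (Y - 1), by positivity, fun w hw => ?_⟩
  have h := (Complex.re_le_norm _).trans (hψ w hw)
  simp only [Complex.sub_re, Complex.add_re, Complex.ofReal_re, Complex.mul_re, Complex.I_re,
    Complex.I_im, Complex.ofReal_im, Complex.mul_im] at h
  have hsplit : w ^ Y = w ^ (Y - 1) * w := by
    rw [← Real.rpow_add_one hw.ne']
    congr 1
    ring
  have hpos : 0 < w ^ (Y - 1) := by positivity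
  rcases le_or_gt w (A / σ) with hle | hlt
  · have h1 : A * w ^ (Y - 1) ≤ A * (A / σ) ^ (Y - 1) := by gcongr
    have h2 : 0 < σ * w ^ Y := by positivity
    linarith
  · have h1 : A < σ * w := by rwa [div_lt_iff₀' hσ] at hlt
    have h2 : 0 ≤ A * (A / σ) ^ (Y - 1) := by positivity
    have h3 := mul_lt_mul_of_pos_right h1 hpos
    rw [hsplit] at h
    linarith

lemma exists_integrable_bound_expansionIntegrand (hσ : 0 < σ) (hY1 : 1 < Y) (hY2 : Y < 2)
    (hA : 0 ≤ A)
    (hψ : ∀ w : ℝ, 0 < w → ‖ψ w + ((σ * w ^ Y : ℝ) : ℂ) - Complex.I * w * b‖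
      ≤ A * (1 + w ^ (Y - 1))) :
    ∃ g : ℝ → ℝ, IntegrableOn g (Set.Ioi 0) ∧ ∀ t : ℝ, 0 < t → t ≤ 1 → ∀ w : ℝ, 0 < w →
      |expansionIntegrand σ Y t w (ψ w)| ≤ g w := by
  obtain ⟨K, hK, hψK⟩ := exists_forall_re_le hσ hY1 hA hψ
  set B := σ + |b| + 2 * A with hB
  have hb0 := abs_nonneg b
  have hB0 : 0 ≤ B := by positivity
  have hre : ∀ w : ℝ, 0 < w → |(ψ w).re + σ * w ^ Y| ≤ A * (1 + w ^ (Y - 1)) := fun w hw => by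
    simpa using (Complex.abs_re_le_norm _).trans (hψ w hw)
  have him : ∀ w : ℝ, 0 < w → |(ψ w).im| ≤ |b| * w + A * (1 + w ^ (Y - 1)) := fun w hw => by
    have h : |(ψ w).im - w * b| ≤ A * (1 + w ^ (Y - 1)) := by
      simpa using (Complex.abs_im_le_norm _).trans (hψ w hw)
    have h2 := abs_add_le ((ψ w).im - w * b) (w * b)
    rw [sub_add_cancel, abs_mul, abs_of_pos hw] at h2
    linarith
  have hnorm : ∀ w : ℝ, 0 < w → ‖ψ w‖ ≤ σ * w ^ Y + |b| * w + A * (1 + w ^ (Y - 1)) :=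
    fun w hw => by
      have h2 := norm_add₃_le (a := ψ w + ((σ * w ^ Y : ℝ) : ℂ) - Complex.I * w * b)
        (b := -((σ * w ^ Y : ℝ) : ℂ)) (c := Complex.I * w * b)
      rw [show ψ w + ((σ * w ^ Y : ℝ) : ℂ) - Complex.I * w * b + -((σ * w ^ Y : ℝ) : ℂ)
        + Complex.I * w * b = ψ w by ring, norm_neg, Complex.norm_real,
        Real.norm_of_nonneg (show 0 ≤ σ * w ^ Y by positivity), norm_mul, norm_mul,
        Complex.norm_I, Complex.norm_real, Complex.norm_real, Real.norm_of_nonneg hw.le,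
        Real.norm_eq_abs] at h2
      linarith [hψ w hw]
  refine ⟨(Set.Ioc 0 1).indicator (fun w => (4 * (Real.exp K * B) + σ) * w ^ (Y - 2))
    + (Set.Ioi 1).indicator
      (fun w => 2 * (Real.exp K * B) * w ^ (Y - 3) + B ^ 2 / (2 * σ) * w ^ (-Y)), ?_, ?_⟩
  · refine Integrable.integrableOn (Integrable.add ?_ ?_)
    · rw [integrable_indicator_iff measurableSet_Ioc]
      exact ((intervalIntegrable_iff_integrableOn_Ioc_of_le zero_le_one).mp
        (intervalIntegral.intervalIntegrable_rpow' (by linarith))).const_mul _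
    · rw [integrable_indicator_iff measurableSet_Ioi]
      exact ((integrableOn_Ioi_rpow_of_lt (by linarith) one_pos).const_mul _).add
        ((integrableOn_Ioi_rpow_of_lt (by linarith) one_pos).const_mul _)
  · intro t ht0 ht1 w hw
    rcases le_or_gt w 1 with hw1 | hw1
    · have hmem : w ∈ Set.Ioc (0 : ℝ) 1 := ⟨hw, hw1⟩
      have hnmem : w ∉ Set.Ioi (1 : ℝ) := hw1.not_gt
      rw [Pi.add_apply, Set.indicator_of_mem hmem, Set.indicator_of_notMem hnmem, add_zero]
      refine abs_expansionIntegrand_le_of_le_one hσ hY2 hK ht0 ht1 hw hw1 (hψK w hw) ?_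
      have e1 : w ^ Y ≤ 1 := Real.rpow_le_one hw.le hw1 (by linarith)
      have e2 : w ^ (Y - 1) ≤ 1 := Real.rpow_le_one hw.le hw1 (by linarith)
      have := hnorm w hw
      nlinarith
    · have hmem : w ∈ Set.Ioi (1 : ℝ) := hw1
      have hnmem : w ∉ Set.Ioc (0 : ℝ) 1 := fun h => h.2.not_gt hw1
      rw [Pi.add_apply, Set.indicator_of_mem hmem, Set.indicator_of_notMem hnmem, zero_add]
      have e1 : 1 ≤ w ^ (Y - 1) := Real.one_le_rpow hw1.le (by linarith)
      have e2 : w ^ (Y - 1) ≤ w := by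
        simpa using Real.rpow_le_rpow_of_exponent_le hw1.le (show Y - 1 ≤ 1 by linarith)
      have e3 : w ≤ w ^ Y := by
        simpa using Real.rpow_le_rpow_of_exponent_le hw1.le (show 1 ≤ Y by linarith)
      refine abs_expansionIntegrand_le_of_one_le hσ hK ht0 ht1 hw1.le (hψK w hw) hB0
        ((hnorm w hw).trans ?_) ((hre w hw).trans ?_) ((him w hw).trans ?_) <;> rw [hB] <;> nlinarith

lemma tendsto_integral_expansionIntegrand (hψm : Measurable ψ) (hσ : 0 < σ) (hY1 : 1 < Y)
    (hY2 : Y < 2) (hA : 0 ≤ A)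
    (hψ : ∀ w : ℝ, 0 < w → ‖ψ w + ((σ * w ^ Y : ℝ) : ℂ) - Complex.I * w * b‖
      ≤ A * (1 + w ^ (Y - 1))) :
    Tendsto (fun t => ∫ w in Set.Ioi (0 : ℝ), expansionIntegrand σ Y t w (ψ w)) (𝓝[>] 0)
      (𝓝 (∫ w in Set.Ioi (0 : ℝ),
        (-(σ * w ^ Y) / w ^ 2 - (ψ w).re / (w ^ 2 + 1 / 4)))) := by
  obtain ⟨g, hg, hbound⟩ := exists_integrable_bound_expansionIntegrand hσ hY1 hY2 hA hψ
  refine MeasureTheory.tendsto_integral_filter_of_dominated_convergence g ?_ ?_ hg ?_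
  · refine Eventually.of_forall fun t => Measurable.aestronglyMeasurable ?_
    unfold expansionIntegrand
    fun_prop
  · filter_upwards [Ioc_mem_nhdsGT (zero_lt_one' ℝ)] with t ht
    filter_upwards [ae_restrict_mem measurableSet_Ioi] with w hw
    exact hbound t ht.1 ht.2 w hw
  · exact Eventually.of_forall fun w => tendsto_expansionIntegrand σ Y w (ψ w)

lemma integral_expansionIntegrand (hψm : Measurable ψ) (hσ : 0 < σ) (hY1 : 1 < Y)
    (hA : 0 ≤ A)
    (hψ : ∀ w : ℝ, 0 < w → ‖ψ w + ((σ * w ^ Y : ℝ) : ℂ) - Complex.I * w * b‖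
      ≤ A * (1 + w ^ (Y - 1))) {t : ℝ} (ht : 0 < t) :
    ∫ w in Set.Ioi (0 : ℝ), expansionIntegrand σ Y t w (ψ w)
      = ((∫ w in Set.Ioi (0 : ℝ),
            (1 - Complex.exp (t * ψ w)) / ((w ^ 2 + 1 / 4 : ℝ) : ℂ)).re
          - (t * σ) ^ (1 / Y) * Real.Gamma (1 - 1 / Y)) / t := by
  obtain ⟨K, hK, hψK⟩ := exists_forall_re_le hσ hY1 hA hψ
  have hint : IntegrableOn (fun w : ℝ =>
      (1 - Complex.exp (t * ψ w)) / ((w ^ 2 + 1 / 4 : ℝ) : ℂ)) (Set.Ioi 0) := by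
    refine ((integrable_inv_one_add_sq.const_mul
      (4 * (1 + Real.exp (t * K)))).integrableOn).mono'
        (Measurable.aestronglyMeasurable (by fun_prop)) ?_
    filter_upwards [ae_restrict_mem measurableSet_Ioi] with w hw
    have h1 : ‖1 - Complex.exp (t * ψ w)‖ ≤ 1 + Real.exp (t * K) := by
      refine (norm_sub_le _ _).trans ?_
      rw [norm_one, Complex.norm_exp, Complex.re_ofReal_mul]
      gcongr
      exact hψK w hw
    rw [norm_div, Complex.norm_real,
      Real.norm_of_nonneg (show (0 : ℝ) ≤ w ^ 2 + 1 / 4 by positivity), div_le_iff₀ (by positivity)]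
    refine h1.trans ?_
    have h2 : 1 ≤ 4 * (1 + w ^ 2)⁻¹ * (w ^ 2 + 1 / 4) := by
      rw [← div_eq_mul_inv, div_mul_eq_mul_div, one_le_div (by positivity)]
      nlinarith [sq_nonneg w]
    have h3 : 0 < 1 + Real.exp (t * K) := by positivity
    nlinarith
  have hre : IntegrableOn (fun w : ℝ => (1 - Complex.exp (t * ψ w)).re / (w ^ 2 + 1 / 4))
      (Set.Ioi 0) := by
    simpa only [IntegrableOn, RCLike.re_eq_complex_re, Complex.div_ofReal_re] using hint.re
  simp only [expansionIntegrand]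
  rw [integral_div, integral_sub hre (integrableOn_one_sub_exp_div_sq (mul_pos ht hσ) hY1),
    integral_one_sub_exp_div_sq (mul_pos ht hσ) hY1]
  congr 2
  have := integral_re hint
  simpa only [RCLike.re_eq_complex_re, Complex.div_ofReal_re] using this

end Exponent

lemma measurable_psi0 (C G M Y : ℝ) : Measurable (psi0 C G M Y) := by
  unfold psi0
  fun_prop

lemma sigmaY_pos {C Y : ℝ} (hC : 0 < C) (hY1 : 1 < Y) (hY2 : Y < 2) : 0 < sigmaY C Y := by
  have h1 := Gamma_neg_pos hY1 hY2
  have h2 := abs_pos.mpr (cos_pi_mul_div_two_neg hY1 hY2).ne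
  unfold sigmaY
  positivity

lemma thetaT_eq_mul_psi0 (C G M : ℝ) {Y t w : ℝ} (hY : 0 < Y) (ht : 0 < t) (hw : 0 < w) :
    thetaT C G M Y t (t ^ (1 / Y) * w) = t * psi0 C G M Y w := by
  have hs : 0 < t ^ (1 / Y) := by positivity
  have hsY : (t ^ (1 / Y)) ^ Y = t := by
    rw [← Real.rpow_mul ht.le, one_div_mul_cancel hY.ne', Real.rpow_one]
  have hst : t ^ (1 / Y) * t ^ (1 - 1 / Y) = t := by
    rw [← Real.rpow_add ht, add_sub_cancel, Real.rpow_one]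
  have hm : ((M - 1 / 2 : ℝ) : ℂ) - Complex.I * w ≠ 0 := fun h => by
    simpa [hw.ne'] using congrArg Complex.im h
  have hg : ((G + 1 / 2 : ℝ) : ℂ) + Complex.I * w ≠ 0 := fun h => by
    simpa [hw.ne'] using congrArg Complex.im h
  have e1 : (((M - 1 / 2) * t ^ (1 / Y) : ℝ) : ℂ) - Complex.I * ((t ^ (1 / Y) * w : ℝ) : ℂ)
      = ((t ^ (1 / Y) : ℝ) : ℂ) * (((M - 1 / 2 : ℝ) : ℂ) - Complex.I * w) := by
    rw [Complex.ofReal_mul, Complex.ofReal_mul]; ring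
  have e2 : (((G + 1 / 2) * t ^ (1 / Y) : ℝ) : ℂ) + Complex.I * ((t ^ (1 / Y) * w : ℝ) : ℂ)
      = ((t ^ (1 / Y) : ℝ) : ℂ) * (((G + 1 / 2 : ℝ) : ℂ) + Complex.I * w) := by
    rw [Complex.ofReal_mul, Complex.ofReal_mul]; ring
  have e3 : Complex.I * ((t ^ (1 / Y) * w : ℝ) : ℂ) * ((btilde C G M Y : ℝ) : ℂ)
        * ((t ^ (1 - 1 / Y) : ℝ) : ℂ)
      = (t : ℂ) * (Complex.I * w * ((btilde C G M Y : ℝ) : ℂ)) := by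
    have : (t : ℂ) = ((t ^ (1 / Y) : ℝ) : ℂ) * ((t ^ (1 - 1 / Y) : ℝ) : ℂ) := by
      rw [← Complex.ofReal_mul, hst]
    rw [this, Complex.ofReal_mul]
    ring
  rw [thetaT, psi0, e1, e2, e3, ofReal_mul_cpow_of_pos hs hm, ofReal_mul_cpow_of_pos hs hg, hsY]
  ring

lemma exists_norm_psi0_add_sub_le {C G M Y : ℝ} (hC : 0 < C) (hG : 0 ≤ G) (hM : 1 < M)
    (hY1 : 1 < Y) (hY2 : Y < 2) :
    ∃ A : ℝ, 0 ≤ A ∧ ∀ w : ℝ, 0 < w →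
      ‖psi0 C G M Y w + ((sigmaY C Y * w ^ Y : ℝ) : ℂ) - Complex.I * w * btilde C G M Y‖
        ≤ A * (1 + w ^ (Y - 1)) := by
  have hΓ := Gamma_neg_pos hY1 hY2
  set D := C * Real.Gamma (-Y) with hD
  have hD0 : 0 < D := mul_pos hC hΓ
  set m := M - 1 / 2 with hm
  set g := G + 1 / 2 with hg
  have hm0 : 0 < m := by linarith
  have hg0 : 0 < g := by linarith
  refine ⟨|kappaC C G M Y| + D * (Y * (m ^ (Y - 1) + 1) * m + Y * (g ^ (Y - 1) + 1) * g),
    by positivity, fun w hw => ?_⟩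
  have hσ : ((sigmaY C Y * w ^ Y : ℝ) : ℂ) = -((D : ℝ) : ℂ) *
      ((Complex.I * (w : ℂ)) ^ (Y : ℂ) + (Complex.I * ((-w : ℝ) : ℂ)) ^ (Y : ℂ)) := by
    rw [I_mul_cpow_add_I_mul_neg_cpow hw, sigmaY, abs_of_neg (cos_pi_mul_div_two_neg hY1 hY2), hD]
    push_cast
    ring
  have hsplit : psi0 C G M Y w + ((sigmaY C Y * w ^ Y : ℝ) : ℂ) - Complex.I * w * btilde C G M Y
      = ((kappaC C G M Y : ℝ) : ℂ) + (D : ℂ) *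
        ((((m : ℂ) + Complex.I * ((-w : ℝ) : ℂ)) ^ (Y : ℂ) - (Complex.I * ((-w : ℝ) : ℂ)) ^ (Y : ℂ))
        + (((g : ℂ) + Complex.I * w) ^ (Y : ℂ) - (Complex.I * w) ^ (Y : ℂ))) := by
    rw [hσ, psi0, show (m : ℂ) + Complex.I * ((-w : ℝ) : ℂ) = (m : ℂ) - Complex.I * w by
      push_cast; ring]
    ring
  have h1 := norm_add_I_mul_cpow_sub_le hm0.le (neg_ne_zero.mpr hw.ne') hY1.le hY2.le
  have h2 := norm_add_I_mul_cpow_sub_le hg0.le hw.ne' hY1.le hY2.le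
  rw [abs_neg, abs_of_pos hw] at h1
  rw [abs_of_pos hw] at h2
  have hp : 0 < w ^ (Y - 1) := by positivity
  have key : ∀ a : ℝ, 0 < a → Y * (a ^ (Y - 1) + w ^ (Y - 1)) * a
      ≤ Y * (a ^ (Y - 1) + 1) * a * (1 + w ^ (Y - 1)) := fun a ha => by
    have : 0 < a ^ (Y - 1) := by positivity
    have h : a ^ (Y - 1) + w ^ (Y - 1) ≤ (a ^ (Y - 1) + 1) * (1 + w ^ (Y - 1)) := by nlinarith
    calc _ ≤ Y * ((a ^ (Y - 1) + 1) * (1 + w ^ (Y - 1))) * a := by gcongr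
      _ = _ := by ring
  rw [hsplit]
  refine (norm_add_le _ _).trans ?_
  rw [norm_mul, Complex.norm_real, Complex.norm_real, Real.norm_eq_abs, Real.norm_of_nonneg hD0.le]
  have h3 := (norm_add_le _ _).trans (add_le_add (h1.trans (key m hm0)) (h2.trans (key g hg0)))
  have h4 := mul_le_mul_of_nonneg_left h3 hD0.le
  have h5 : 0 ≤ |kappaC C G M Y| * w ^ (Y - 1) := by positivity
  linarith

lemma LLfn_eq (C G M : ℝ) {Y t : ℝ} (hY : 0 < Y) (ht : 0 < t) :
    LLfn C G M Y t = (1 / Real.pi) * ((t ^ (1 / Y))⁻¹ *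
      (∫ w in Set.Ioi (0 : ℝ),
        (1 - Complex.exp (t * psi0 C G M Y w)) / ((w ^ 2 + 1 / 4 : ℝ) : ℂ)).re) := by
  have hs : 0 < t ^ (1 / Y) := by positivity
  have hs2 : t ^ (2 / Y) = (t ^ (1 / Y)) ^ 2 := by
    rw [← Real.rpow_mul_natCast ht.le]
    congr 1
    push_cast
    ring
  have hsub := integral_comp_mul_left_Ioi (fun v : ℝ =>
    (1 - Complex.exp (thetaT C G M Y t v)) / ((v ^ 2 + t ^ (2 / Y) / 4 : ℝ) : ℂ)) 0 hs
  have hpt : ∫ w in Set.Ioi (0 : ℝ), (1 - Complex.exp (thetaT C G M Y t (t ^ (1 / Y) * w)))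
        / (((t ^ (1 / Y) * w) ^ 2 + t ^ (2 / Y) / 4 : ℝ) : ℂ)
      = ∫ w in Set.Ioi (0 : ℝ), (((t ^ (1 / Y)) ^ 2)⁻¹ : ℝ) •
        ((1 - Complex.exp (t * psi0 C G M Y w)) / ((w ^ 2 + 1 / 4 : ℝ) : ℂ)) := by
    refine setIntegral_congr_fun measurableSet_Ioi fun w hw => ?_
    rw [thetaT_eq_mul_psi0 C G M hY ht hw, hs2, show (t ^ (1 / Y) * w) ^ 2 + (t ^ (1 / Y)) ^ 2 / 4
      = (t ^ (1 / Y)) ^ 2 * (w ^ 2 + 1 / 4) by ring, Complex.ofReal_mul, Complex.real_smul,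
      Complex.ofReal_inv, div_mul_eq_div_div, div_eq_inv_mul (1 - _)]
    ring
  rw [hpt, integral_smul, mul_zero, eq_inv_smul_iff₀ hs.ne'] at hsub
  rw [LLfn, ← hsub, smul_smul, Complex.smul_re, smul_eq_mul]
  congr 2
  field_simp

/-- Second-order ATM asymptotics: `lim_{t→0⁺} (L(t) - d₁)/t^{1-1/Y} = d₂`. -/
theorem stmt2 (C G M Y : ℝ) (hC : 0 < C) (hG : 0 ≤ G) (hM : 1 < M)
    (hY1 : 1 < Y) (hY2 : Y < 2) :
    Tendsto (fun t : ℝ => (LLfn C G M Y t - dOne C Y) / t ^ (1 - 1/Y))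
      (𝓝[>] 0) (𝓝 (dTwo C G M Y)) := by
  have hσ := sigmaY_pos hC hY1 hY2
  have hψm := measurable_psi0 C G M Y
  obtain ⟨A, hA, hψ⟩ := exists_norm_psi0_add_sub_le hC hG hM hY1 hY2
  have hlim := (tendsto_integral_expansionIntegrand hψm hσ hY1 hY2 hA hψ).const_mul (1 / Real.pi)
  have hd : dTwo C G M Y = 1 / Real.pi * ∫ w in Set.Ioi (0 : ℝ),
      (-(sigmaY C Y * w ^ Y) / w ^ 2 - (psi0 C G M Y w).re / (w ^ 2 + 1 / 4)) := by
    rw [dTwo]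
    congr 1
    refine setIntegral_congr_fun measurableSet_Ioi fun w hw => ?_
    have hw0 : (0 : ℝ) < w := hw
    rw [theta0, abs_of_pos hw0]
    field_simp
  rw [hd]
  refine hlim.congr' ?_
  filter_upwards [self_mem_nhdsWithin] with t ht
  have ht0 : (0 : ℝ) < t := ht
  rw [integral_expansionIntegrand hψm hσ hY1 hA hψ ht0, LLfn_eq C G M (by linarith) ht0, dOne,
    Real.mul_rpow ht0.le hσ.le, Real.rpow_sub ht0, Real.rpow_one]
  have hs : 0 < t ^ (1 / Y) := by positivity
  generalize (∫ w in Set.Ioi (0 : ℝ),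
    (1 - Complex.exp (t * psi0 C G M Y w)) / ((w ^ 2 + 1 / 4 : ℝ) : ℂ)).re = J
  field_simp
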